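/- Let G be a countable abelian group with [G:2G] = ℓ < ∞ and |ker(D)| = r < ∞ where r < ℓ. Then there exist Følner sequences in G with doubling ratio arbitrarily close to r/ℓ; more precisely α_G = r/ℓ and the supremum is attained by some Følner sequence. -/

import Mathlib

open Filter Pointwise
open scoped Classical

/-- The doubling map `g ↦ g + g` as an additive homomorphism. -/
def doubleHom (G : Type*) [AddCommGroup G] : G →+ G where
  toFun g := g + g
  map_zero' := by simp
  map_add' := by intro a b; abel

/-- The subgroup `2G = {g + g : g ∈ G}`. -/
def twoG (G : Type*) [AddCommGroup G] : AddSubgroup G := (doubleHom G).range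

/-- A Følner sequence: finite sets with `|Φ_N ∩ (g + Φ_N)|/|Φ_N| → 1` for every `g`. -/
def IsFolner {G : Type*} [AddCommGroup G] (Φ : ℕ → Finset G) : Prop :=
  ∀ g : G, Tendsto
    (fun N => (((Φ N) ∩ (Φ N).image (fun x => g + x)).card : ℝ) / ((Φ N).card : ℝ))
    atTop (nhds 1)

/-- The doubling ratio of a Følner sequence:
`α_Φ = liminf |Φ_N/2 ∩ Φ_N| / |Φ_N|`. -/
noncomputable def dratio {G : Type*} [AddCommGroup G] (Φ : ℕ → Finset G) : ℝ :=
  Filter.liminf (fun N =>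
    (((((fun x : G => x + x) ⁻¹' (Φ N : Set G)) ∩ (Φ N : Set G)).ncard : ℝ) /
      ((Φ N).card : ℝ))) atTop

section Aux

variable {G : Type*} [AddCommGroup G]

/-- Translation defect. -/
noncomputable def defect (g : G) (A : Finset G) : Finset G :=
  A \ A.image (fun x => g + x)

theorem mem_defect {g : G} {A : Finset G} {x : G} :
    x ∈ defect g A ↔ x ∈ A ∧ x - g ∉ A := by
  unfold defect
  simp only [Finset.mem_sdiff, Finset.mem_image, not_exists, not_and]
  constructor
  · rintro ⟨h1, h2⟩
    exact ⟨h1, fun h => h2 _ h (by abel)⟩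
  · rintro ⟨h1, h2⟩
    refine ⟨h1, fun y hy h => h2 ?_⟩
    rw [← h]
    simpa using hy

/-- Convenient form of the Folner property. -/
def Fol (Φ : ℕ → Finset G) : Prop :=
  (∀ g : G, Tendsto (fun N => ((defect g (Φ N)).card : ℝ) / ((Φ N).card : ℝ)) atTop (nhds 0)) ∧
  ∀ᶠ N in atTop, (Φ N).Nonempty

theorem inter_add_defect (g : G) (A : Finset G) (hA : A.Nonempty) :
    ((A ∩ A.image (fun x => g + x)).card : ℝ) / (A.card : ℝ)
      = 1 - ((defect g A).card : ℝ) / (A.card : ℝ) := by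
  have h : (A ∩ A.image (fun x => g + x)).card + (defect g A).card = A.card := by
    unfold defect
    exact Finset.card_inter_add_card_sdiff _ _
  have hpos : (A.card : ℝ) ≠ 0 := by
    have := hA.card_pos
    positivity
  have h' : ((A ∩ A.image (fun x => g + x)).card : ℝ) + ((defect g A).card : ℝ) = A.card := by
    exact_mod_cast h
  field_simp
  linarith

theorem fol_iff (Φ : ℕ → Finset G) : IsFolner Φ ↔ Fol Φ := by
  constructor
  · intro h
    have hne : ∀ᶠ N in atTop, (Φ N).Nonempty := by
      have := (h 0).eventually (lt_mem_nhds (show (0:ℝ) < 1 by norm_num))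
      filter_upwards [this] with N hN
      by_contra hc
      rw [Finset.not_nonempty_iff_eq_empty] at hc
      rw [hc] at hN
      simp at hN
    refine ⟨fun g => ?_, hne⟩
    have h1 := (h g).const_sub 1
    rw [sub_self] at h1
    refine h1.congr' ?_
    filter_upwards [hne] with N hN
    rw [inter_add_defect g _ hN]
    ring
  · rintro ⟨h, hne⟩ g
    have h1 := (h g).const_sub 1
    rw [sub_zero] at h1
    refine h1.congr' ?_
    filter_upwards [hne] with N hN
    rw [inter_add_defect g _ hN]

/-- The preimage of a finite set under doubling. -/
noncomputable def half (A : Finset G) : Finset G :=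
  if h : ((fun x : G => x + x) ⁻¹' (A : Set G)).Finite then h.toFinset else ∅

theorem fiber_eq (x0 : G) :
    {x : G | x + x = x0 + x0} = (fun k => x0 + k) '' ((doubleHom G).ker : Set G) := by
  ext x
  simp only [Set.mem_ofPred_eq, Set.mem_image, SetLike.mem_coe, AddMonoidHom.mem_ker]
  constructor
  · intro h
    refine ⟨x - x0, ?_, by abel⟩
    change (x - x0) + (x - x0) = 0
    have : (x - x0) + (x - x0) = (x + x) - (x0 + x0) := by abel
    rw [this, h, sub_self]
  · rintro ⟨k, hk, rfl⟩
    change k + k = 0 at hk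
    have : (x0 + k) + (x0 + k) = (x0 + x0) + (k + k) := by abel
    rw [this, hk, add_zero]

theorem fiber_ncard (x0 : G) :
    {x : G | x + x = x0 + x0}.ncard = Nat.card (doubleHom G).ker := by
  rw [fiber_eq, Set.ncard_image_of_injective _ (add_right_injective x0)]
  rfl

theorem pre_finite (hk : Finite (doubleHom G).ker) (A : Finset G) :
    ((fun x : G => x + x) ⁻¹' (A : Set G)).Finite := by
  refine Set.Finite.preimage' A.finite_toSet ?_
  intro b _
  by_cases hb : ∃ x0 : G, x0 + x0 = b
  · obtain ⟨x0, rfl⟩ := hb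
    have : (fun x : G => x + x) ⁻¹' {x0 + x0} = {x : G | x + x = x0 + x0} := rfl
    rw [this, fiber_eq]
    exact Set.Finite.image _ (Set.toFinite _)
  · convert Set.finite_empty
    ext x
    simp only [Set.mem_preimage, Set.mem_singleton_iff, Set.mem_empty_iff_false, iff_false]
    exact fun h => hb ⟨x, h⟩

theorem mem_half (hk : Finite (doubleHom G).ker) {A : Finset G} {x : G} :
    x ∈ half A ↔ x + x ∈ A := by
  unfold half
  rw [dif_pos (pre_finite hk A)]
  simp

theorem card_half (hk : Finite (doubleHom G).ker) (A : Finset G) :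
    (half A).card = (A.filter (fun y => y ∈ twoG G)).card * Nat.card (doubleHom G).ker := by
  have hm : ∀ x ∈ half A, x + x ∈ A.filter (fun y => y ∈ twoG G) := by
    intro x hx
    rw [mem_half hk] at hx
    exact Finset.mem_filter.2 ⟨hx, ⟨x, rfl⟩⟩
  rw [Finset.card_eq_sum_card_fiberwise (f := fun x => x + x) (s := half A)
    (t := A.filter (fun y => y ∈ twoG G)) (fun x hx => hm x hx)]
  rw [Finset.sum_const_nat]
  intro y hy
  obtain ⟨hyA, x0, hx0⟩ := Finset.mem_filter.1 hy
  change x0 + x0 = y at hx0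
  subst hx0
  rw [← fiber_ncard x0, ← Set.ncard_coe_finset]
  congr 1
  ext x
  simp only [Finset.coe_filter, mem_half hk, Set.mem_ofPred_eq]
  constructor
  · exact fun h => h.2
  · intro h
    exact ⟨by rw [h]; exact hyA, h⟩

theorem defect_half (hk : Finite (doubleHom G).ker) (g : G) (A : Finset G) :
    (defect g (half A)).card ≤ (defect (g + g) A).card * Nat.card (doubleHom G).ker := by
  have h : defect g (half A) = half (defect (g + g) A) := by
    ext x
    rw [mem_half hk, mem_defect, mem_defect, mem_half hk, mem_half hk]
    have : x - g + (x - g) = x + x - (g + g) := by abel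
    rw [this]
  rw [h, card_half hk]
  exact Nat.mul_le_mul_right _ (Finset.card_filter_le _ _)

theorem coset_le (A : Finset G) (c : G) (H : AddSubgroup G) :
    (A.filter (fun y : G => (y : G ⧸ H) = (c : G ⧸ H))).card
      ≤ (A.filter (fun y => y ∈ H)).card + (defect c A).card := by
  have hsub : (A.filter (fun y : G => (y : G ⧸ H) = (c : G ⧸ H))) ⊆
      (A.filter (fun y => y ∈ H)).image (fun x => c + x) ∪ defect c A := by
    intro x hx
    rw [Finset.mem_filter] at hx
    by_cases hxc : x - c ∈ A
    · refine Finset.mem_union_left _ (Finset.mem_image.2 ⟨x - c, ?_, by abel⟩)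
      refine Finset.mem_filter.2 ⟨hxc, ?_⟩
      have := QuotientAddGroup.eq.1 hx.2.symm
      rwa [neg_add_eq_sub] at this
    · exact Finset.mem_union_right _ (mem_defect.2 ⟨hx.1, hxc⟩)
  refine (Finset.card_le_card hsub).trans ((Finset.card_union_le _ _).trans ?_)
  exact Nat.add_le_add_right Finset.card_image_le _

theorem le_coset (A : Finset G) (c : G) (H : AddSubgroup G) :
    (A.filter (fun y => y ∈ H)).card ≤
      (A.filter (fun y : G => (y : G ⧸ H) = (c : G ⧸ H))).card + (defect (-c) A).card := by
  have hsub : (A.filter (fun y => y ∈ H)) ⊆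
      (A.filter (fun y : G => (y : G ⧸ H) = (c : G ⧸ H))).image (fun x => -c + x)
        ∪ defect (-c) A := by
    intro x hx
    rw [Finset.mem_filter] at hx
    by_cases hxc : x - -c ∈ A
    · refine Finset.mem_union_left _ (Finset.mem_image.2 ⟨x - -c, ?_, by abel⟩)
      refine Finset.mem_filter.2 ⟨hxc, ?_⟩
      refine (QuotientAddGroup.eq.2 ?_).symm
      have : -c + (x - -c) = x := by abel
      rw [this]
      exact hx.2
    · exact Finset.mem_union_right _ (mem_defect.2 ⟨hx.1, hxc⟩)
  refine (Finset.card_le_card hsub).trans ((Finset.card_union_le _ _).trans ?_)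
  exact Nat.add_le_add_right Finset.card_image_le _

theorem coset_density (Φ : ℕ → Finset G) (hΦ : Fol Φ) (H : AddSubgroup G) (hH : H.index ≠ 0) :
    Tendsto (fun N => (((Φ N).filter (fun y => y ∈ H)).card : ℝ) / ((Φ N).card : ℝ))
      atTop (nhds (1 / (H.index : ℝ))) := by
  have : H.FiniteIndex := ⟨hH⟩
  have : Finite (G ⧸ H) := AddSubgroup.finite_quotient_of_finiteIndex
  have := Fintype.ofFinite (G ⧸ H)
  have hl : (Finset.univ : Finset (G ⧸ H)).card = H.index := by
    rw [Finset.card_univ, AddSubgroup.index, Nat.card_eq_fintype_card]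
  have hsum : ∀ A : Finset G, A.card =
      ∑ q : G ⧸ H, (A.filter (fun y : G => (y : G ⧸ H) = ((Quotient.out q : G) : G ⧸ H))).card := by
    intro A
    rw [Finset.card_eq_sum_card_fiberwise (f := fun x : G => (x : G ⧸ H)) (t := Finset.univ)
      (by intro x _; simp)]
    refine Finset.sum_congr rfl fun q _ => ?_
    rw [QuotientAddGroup.out_eq']
  have hup : ∀ A : Finset G, A.card ≤ H.index * (A.filter (fun y => y ∈ H)).card
      + ∑ q : G ⧸ H, (defect (Quotient.out q : G) A).card := by
    intro A
    conv_lhs => rw [hsum A]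
    refine (Finset.sum_le_sum fun q _ => coset_le A (Quotient.out q : G) H).trans ?_
    rw [Finset.sum_add_distrib, Finset.sum_const, hl, smul_eq_mul]
    exact le_rfl
  have hlo : ∀ A : Finset G, H.index * (A.filter (fun y => y ∈ H)).card ≤ A.card
      + ∑ q : G ⧸ H, (defect (-(Quotient.out q : G)) A).card := by
    intro A
    conv_rhs => rw [hsum A]
    rw [← Finset.sum_add_distrib, ← hl, ← smul_eq_mul, ← Finset.sum_const]
    exact Finset.sum_le_sum fun q _ => le_coset A (Quotient.out q : G) H
  have hL : (0:ℝ) < H.index := by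
    have := Nat.pos_of_ne_zero hH
    exact_mod_cast this
  have t1 : Tendsto (fun N => (1 - ∑ q : G ⧸ H,
      ((defect (Quotient.out q : G) (Φ N)).card : ℝ) / ((Φ N).card : ℝ)) / (H.index : ℝ))
      atTop (nhds ((1 - ∑ q : G ⧸ H, (0:ℝ)) / (H.index : ℝ))) :=
    ((tendsto_finsetSum _ fun q _ => hΦ.1 _).const_sub 1).div_const _
  have t2 : Tendsto (fun N => (1 + ∑ q : G ⧸ H,
      ((defect (-(Quotient.out q : G)) (Φ N)).card : ℝ) / ((Φ N).card : ℝ)) / (H.index : ℝ))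
      atTop (nhds ((1 + ∑ q : G ⧸ H, (0:ℝ)) / (H.index : ℝ))) :=
    ((tendsto_finsetSum _ fun q _ => hΦ.1 _).const_add 1).div_const _
  simp only [Finset.sum_const_zero, sub_zero, add_zero] at t1 t2
  refine tendsto_of_tendsto_of_tendsto_of_le_of_le' t1 t2 ?_ ?_
  · filter_upwards [hΦ.2] with N hN
    have hc : (0:ℝ) < (Φ N).card := by exact_mod_cast hN.card_pos
    have h := hup (Φ N)
    have h' : ((Φ N).card : ℝ) ≤ H.index * ((Φ N).filter (fun y => y ∈ H)).card
      + ∑ q : G ⧸ H, ((defect (Quotient.out q : G) (Φ N)).card : ℝ) := by exact_mod_cast h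
    rw [← Finset.sum_div, div_le_div_iff₀ hL hc, sub_mul, div_mul_cancel₀ _ hc.ne']
    linarith
  · filter_upwards [hΦ.2] with N hN
    have hc : (0:ℝ) < (Φ N).card := by exact_mod_cast hN.card_pos
    have h := hlo (Φ N)
    have h' : (H.index : ℝ) * ((Φ N).filter (fun y => y ∈ H)).card ≤ ((Φ N).card : ℝ)
      + ∑ q : G ⧸ H, ((defect (-(Quotient.out q : G)) (Φ N)).card : ℝ) := by exact_mod_cast h
    rw [← Finset.sum_div, div_le_div_iff₀ hc hL, add_mul, div_mul_cancel₀ _ hc.ne']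
    linarith

theorem half_density (hk : Finite (doubleHom G).ker) (hH : (twoG G).index ≠ 0)
    (Φ : ℕ → Finset G) (hΦ : Fol Φ) :
    Tendsto (fun N => ((half (Φ N)).card : ℝ) / ((Φ N).card : ℝ)) atTop
      (nhds ((Nat.card (doubleHom G).ker : ℝ) / ((twoG G).index : ℝ))) := by
  have h := (coset_density Φ hΦ _ hH).mul_const (Nat.card (doubleHom G).ker : ℝ)
  rw [one_div, ← div_eq_inv_mul] at h
  refine h.congr fun N => ?_
  rw [card_half hk]
  push_cast
  ring

theorem fol_half (hk : Finite (doubleHom G).ker) (hH : (twoG G).index ≠ 0)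
    (Φ : ℕ → Finset G) (hΦ : Fol Φ) : Fol (fun N => half (Φ N)) := by
  have hd := half_density hk hH Φ hΦ
  have hr : (0:ℝ) < (Nat.card (doubleHom G).ker : ℝ) := by exact_mod_cast Nat.card_pos
  have hl : (0:ℝ) < ((twoG G).index : ℝ) := by exact_mod_cast Nat.pos_of_ne_zero hH
  have hpos := div_pos hr hl
  have hne : ∀ᶠ N in atTop, (half (Φ N)).Nonempty := by
    filter_upwards [hd.eventually (lt_mem_nhds hpos)] with N hN
    by_contra hc
    rw [Finset.not_nonempty_iff_eq_empty] at hc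
    rw [hc] at hN
    simp at hN
  refine ⟨fun g => ?_, hne⟩
  have h1 := (((hΦ.1 (g + g)).mul_const (Nat.card (doubleHom G).ker : ℝ)).div hd hpos.ne')
  rw [zero_mul, zero_div] at h1
  refine squeeze_zero' (Eventually.of_forall fun N => by positivity) ?_ h1
  filter_upwards [hne, hΦ.2] with N hN hN2
  have hc : (0:ℝ) < (half (Φ N)).card := by exact_mod_cast hN.card_pos
  have hc2 : (0:ℝ) < (Φ N).card := by exact_mod_cast hN2.card_pos
  have h := defect_half hk g (Φ N)
  have h' : ((defect g (half (Φ N))).card : ℝ) ≤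
    (defect (g + g) (Φ N)).card * Nat.card (doubleHom G).ker := by exact_mod_cast h
  have e : ((defect (g + g) (Φ N)).card : ℝ) / ((Φ N).card : ℝ) * Nat.card (doubleHom G).ker /
      (((half (Φ N)).card : ℝ) / ((Φ N).card : ℝ)) =
      ((defect (g + g) (Φ N)).card * Nat.card (doubleHom G).ker) / ((half (Φ N)).card : ℝ) := by
    field_simp
  change _ ≤ ((defect (g + g) (Φ N)).card : ℝ) / ((Φ N).card : ℝ) * Nat.card (doubleHom G).ker /
      (((half (Φ N)).card : ℝ) / ((Φ N).card : ℝ))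
  rw [e]
  gcongr

theorem fol_union (Φ Ψ : ℕ → Finset G) (hΦ : Fol Φ) (hΨ : Fol Ψ) :
    Fol (fun N => Φ N ∪ Ψ N) := by
  refine ⟨fun g => ?_, ?_⟩
  · have h := (hΦ.1 g).add (hΨ.1 g)
    rw [add_zero] at h
    refine squeeze_zero' (Eventually.of_forall fun N => by positivity) ?_ h
    filter_upwards [hΦ.2, hΨ.2] with N h1 h2
    have c1 : (0:ℝ) < (Φ N).card := by exact_mod_cast h1.card_pos
    have c2 : (0:ℝ) < (Ψ N).card := by exact_mod_cast h2.card_pos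
    have hs : defect g (Φ N ∪ Ψ N) ⊆ defect g (Φ N) ∪ defect g (Ψ N) := by
      intro x
      simp only [mem_defect, Finset.mem_union]
      tauto
    have h3 : ((defect g (Φ N ∪ Ψ N)).card : ℝ) ≤
        (defect g (Φ N)).card + (defect g (Ψ N)).card := by
      exact_mod_cast (Finset.card_le_card hs).trans (Finset.card_union_le _ _)
    have h4 : ((Φ N).card : ℝ) ≤ (Φ N ∪ Ψ N).card := by
      exact_mod_cast Finset.card_le_card Finset.subset_union_left
    have h5 : ((Ψ N).card : ℝ) ≤ (Φ N ∪ Ψ N).card := by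
      exact_mod_cast Finset.card_le_card Finset.subset_union_right
    calc ((defect g (Φ N ∪ Ψ N)).card : ℝ) / ((Φ N ∪ Ψ N).card : ℝ)
        ≤ ((defect g (Φ N)).card + (defect g (Ψ N)).card) / ((Φ N ∪ Ψ N).card : ℝ) := by gcongr
      _ = (defect g (Φ N)).card / ((Φ N ∪ Ψ N).card : ℝ)
          + (defect g (Ψ N)).card / ((Φ N ∪ Ψ N).card : ℝ) := add_div _ _ _
      _ ≤ _ := by gcongr
  · filter_upwards [hΦ.2] with N h1
    exact h1.mono Finset.subset_union_left

/-- The union of the first iterated halves. -/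
noncomputable def uni : ℕ → Finset G → Finset G
  | 0, A => A
  | k + 1, A => A ∪ half (uni k A)

theorem subset_uni (k : ℕ) (A : Finset G) : A ⊆ uni k A := by
  cases k with
  | zero => exact subset_rfl
  | succ k => exact Finset.subset_union_left

theorem half_uni (hk : Finite (doubleHom G).ker) (k : ℕ) (A : Finset G) :
    half (uni k A) \ uni k A ⊆ half^[k + 1] A := by
  induction k with
  | zero =>
    simp only [uni, zero_add, Function.iterate_one]
    exact Finset.sdiff_subset
  | succ k ih =>
    intro x hx
    rw [Function.iterate_succ_apply', mem_half hk]
    apply ih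
    rw [Finset.mem_sdiff, mem_half hk] at hx
    simp only [uni, Finset.mem_union, mem_half hk, not_or] at hx
    rw [Finset.mem_sdiff, mem_half hk]
    rcases hx with ⟨h1 | h1, h2, h3⟩
    · exact absurd (subset_uni k A h1) h3
    · exact ⟨h1, h3⟩

theorem fol_uni (hk : Finite (doubleHom G).ker) (hH : (twoG G).index ≠ 0)
    (Φ : ℕ → Finset G) (hΦ : Fol Φ) (k : ℕ) : Fol (fun N => uni k (Φ N)) := by
  induction k with
  | zero => exact hΦ
  | succ k ih => exact fol_union _ _ hΦ (fol_half hk hH _ ih)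

theorem iter_density (hk : Finite (doubleHom G).ker) (hH : (twoG G).index ≠ 0)
    (Φ : ℕ → Finset G) (hΦ : Fol Φ) (k : ℕ) :
    Fol (fun N => half^[k] (Φ N)) ∧
    Tendsto (fun N => ((half^[k] (Φ N)).card : ℝ) / ((Φ N).card : ℝ)) atTop
      (nhds (((Nat.card (doubleHom G).ker : ℝ) / ((twoG G).index : ℝ)) ^ k)) := by
  induction k with
  | zero =>
    refine ⟨hΦ, ?_⟩
    rw [pow_zero]
    refine tendsto_const_nhds.congr' ?_
    filter_upwards [hΦ.2] with N hN
    have hc : (0:ℝ) < (Φ N).card := by exact_mod_cast hN.card_pos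
    simp [hc.ne']
  | succ k ih =>
    have e : ∀ N, half^[k + 1] (Φ N) = half (half^[k] (Φ N)) :=
      fun N => Function.iterate_succ_apply' _ _ _
    simp only [e]
    refine ⟨fol_half hk hH _ ih.1, ?_⟩
    have h := ih.2.mul (half_density hk hH _ ih.1)
    rw [← pow_succ] at h
    refine h.congr' ?_
    filter_upwards [hΦ.2, ih.1.2] with N h1 h2
    have c1 : (0:ℝ) < (Φ N).card := by exact_mod_cast h1.card_pos
    have c2 : (0:ℝ) < (half^[k] (Φ N)).card := by exact_mod_cast h2.card_pos
    field_simp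

/-- Existence of almost invariant finite sets, by polynomial growth. -/
theorem exists_inv (F : Finset G) (ε : ℝ) (hε : 0 < ε) :
    ∃ A : Finset G, A.Nonempty ∧ ∀ g ∈ F, ((defect g A).card : ℝ) ≤ ε * A.card := by
  let P : ℕ → Finset G := fun n =>
    (Fintype.piFinset (fun _ : F => Finset.range (n + 1))).image (fun a => ∑ i : F, a i • (i : G))
  have hmem : ∀ n x, x ∈ P n ↔ ∃ a : F → ℕ, (∀ i, a i < n + 1) ∧ ∑ i : F, a i • (i : G) = x := by
    intro n x
    simp [P, Fintype.mem_piFinset]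
  have hcard : ∀ n, (P n).card ≤ (n + 1) ^ F.card := by
    intro n
    refine Finset.card_image_le.trans ?_
    simp
  have hne : ∀ n, (P n).Nonempty := fun n => ⟨0, (hmem n 0).2 ⟨0, by simp, by simp⟩⟩
  have hmono : ∀ n, P n ⊆ P (n + 1) := by
    intro n x hx
    obtain ⟨a, ha, rfl⟩ := (hmem _ _).1 hx
    exact (hmem _ _).2 ⟨a, fun i => (ha i).trans (by omega), rfl⟩
  have hadd : ∀ n, ∀ g ∈ F, ∀ x ∈ P n, g + x ∈ P (n + 1) := by
    intro n g hg x hx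
    obtain ⟨a, ha, rfl⟩ := (hmem _ _).1 hx
    refine (hmem _ _).2 ⟨a + Pi.single ⟨g, hg⟩ 1, fun i => ?_, ?_⟩
    · have h1 := ha i
      by_cases h : i = ⟨g, hg⟩
      · subst h
        simp
        omega
      · simp [h]
        omega
    · simp only [Pi.add_apply, add_smul, Finset.sum_add_distrib]
      rw [add_comm]
      congr 1
      rw [Finset.sum_eq_single (⟨g, hg⟩ : F)]
      · simp
      · intro b _ hb
        simp [hb]
      · simp
  obtain ⟨n, hn⟩ : ∃ n, ((P (n + 1)).card : ℝ) ≤ (1 + ε) * (P n).card := by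
    by_contra! hc
    have hgrow : ∀ n, (1 + ε) ^ n ≤ ((P n).card : ℝ) := by
      intro n
      induction n with
      | zero =>
        rw [pow_zero]
        exact_mod_cast (hne 0).card_pos
      | succ n ih =>
        rw [pow_succ']
        refine le_trans ?_ (hc n).le
        gcongr
    have hlim := tendsto_pow_const_div_const_pow_of_one_lt F.card
      (show (1:ℝ) < 1 + ε by linarith)
    have hlim1 := (hlim.comp (tendsto_add_atTop_nat 1))
    have hsm := hlim1.eventually (gt_mem_nhds (show (0:ℝ) < 1 / (1 + ε) by positivity))
    obtain ⟨n, hn⟩ := hsm.exists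
    simp only [Function.comp_apply] at hn
    have h1 : ((P n).card : ℝ) ≤ ((n + 1 : ℕ) : ℝ) ^ F.card := by exact_mod_cast hcard n
    have h2 := hgrow n
    rw [div_lt_div_iff₀ (by positivity) (by positivity), pow_succ] at hn
    have : (0:ℝ) < 1 + ε := by linarith
    nlinarith
  refine ⟨P n, hne n, fun g hg => ?_⟩
  have hd : (defect g (P n)).card + (P n).card ≤ (P (n + 1)).card := by
    have h1 : ((P n).image (fun x => g + x)).card = (P n).card :=
      Finset.card_image_of_injective _ (add_right_injective g)
    rw [← h1]
    unfold defect
    rw [← Finset.card_union_of_disjoint Finset.sdiff_disjoint]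
    refine Finset.card_le_card (Finset.union_subset (Finset.sdiff_subset.trans (hmono n)) ?_)
    intro y hy
    obtain ⟨x, hx, rfl⟩ := Finset.mem_image.1 hy
    exact hadd n g hg x hx
  have hd' : ((defect g (P n)).card : ℝ) + (P n).card ≤ (P (n + 1)).card := by exact_mod_cast hd
  linarith

/-- From almost invariant sets with a property to a Folner sequence. -/
theorem exists_seq [Countable G] (p : ℕ → Finset G → Prop)
    (h : ∀ (F : Finset G) (n : ℕ), ∃ A : Finset G, A.Nonempty ∧ p n A ∧
      ∀ g ∈ F, ((defect g A).card : ℝ) ≤ (1 / ((n : ℝ) + 1)) * A.card) :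
    ∃ Φ : ℕ → Finset G, Fol Φ ∧ ∀ n, p n (Φ n) := by
  obtain ⟨e, he⟩ := exists_surjective_nat G
  choose Φ h1 h2 h3 using fun n : ℕ => h ((Finset.range (n + 1)).image e) n
  refine ⟨Φ, ⟨fun g => ?_, Eventually.of_forall h1⟩, h2⟩
  obtain ⟨i, rfl⟩ := he g
  refine squeeze_zero' (Eventually.of_forall fun N => by positivity) ?_
    tendsto_one_div_add_atTop_nhds_zero_nat
  filter_upwards [eventually_ge_atTop i] with N hN
  have hc : (0:ℝ) < (Φ N).card := by exact_mod_cast (h1 N).card_pos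
  rw [div_le_iff₀ hc]
  exact h3 N _ (Finset.mem_image_of_mem _ (Finset.mem_range.2 (by omega)))

theorem ratio_eq (hk : Finite (doubleHom G).ker) (A : Finset G) :
    (((fun x : G => x + x) ⁻¹' (A : Set G)) ∩ (A : Set G)).ncard = (half A ∩ A).card := by
  rw [← Set.ncard_coe_finset]
  congr 1
  ext x
  simp [mem_half hk]

theorem exists_good [Countable G] (hk : Finite (doubleHom G).ker) (hH : (twoG G).index ≠ 0)
    (hlt : Nat.card (doubleHom G).ker < (twoG G).index) :
    ∃ Φ : ℕ → Finset G, Fol Φ ∧ ∀ n : ℕ,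
      (Nat.card (doubleHom G).ker : ℝ) / ((twoG G).index : ℝ) - 1 / ((n : ℝ) + 1)
        ≤ ((half (Φ n) ∩ Φ n).card : ℝ) / ((Φ n).card : ℝ) := by
  obtain ⟨Ψ, hΨ, -⟩ := exists_seq (G := G) (fun _ _ => True) (fun F n => by
    obtain ⟨A, h1, h2⟩ := exists_inv F (1 / ((n : ℝ) + 1)) (by positivity)
    exact ⟨A, h1, trivial, h2⟩)
  refine exists_seq (fun n A =>
    (Nat.card (doubleHom G).ker : ℝ) / ((twoG G).index : ℝ) - 1 / ((n : ℝ) + 1)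
        ≤ ((half A ∩ A).card : ℝ) / (A.card : ℝ)) ?_
  intro F n
  set q : ℝ := (Nat.card (doubleHom G).ker : ℝ) / ((twoG G).index : ℝ) with hq
  have hl : (0:ℝ) < ((twoG G).index : ℝ) := by exact_mod_cast Nat.pos_of_ne_zero hH
  have hq0 : 0 ≤ q := by positivity
  have hq1 : q < 1 := by
    rw [hq, div_lt_one hl]
    exact_mod_cast hlt
  have hε : (0:ℝ) < 1 / ((n : ℝ) + 1) := by positivity
  obtain ⟨k, hkq⟩ : ∃ k : ℕ, q ^ k < 1 / ((n : ℝ) + 1) := exists_pow_lt_of_lt_one hε hq1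
  have hkq' : q ^ (k + 1) < 1 / ((n : ℝ) + 1) :=
    lt_of_le_of_lt (pow_le_pow_of_le_one hq0 hq1.le (Nat.le_succ k)) hkq
  have hU := fol_uni hk hH Ψ hΨ k
  have hT := (half_density hk hH _ hU).sub (iter_density hk hH Ψ hΨ (k + 1)).2
  have hev := hT.eventually (lt_mem_nhds (show q - 1 / ((n : ℝ) + 1) < q - q ^ (k + 1) by linarith))
  have hF : ∀ᶠ N in atTop, ∀ g ∈ F,
      ((defect g (uni k (Ψ N))).card : ℝ) / ((uni k (Ψ N)).card : ℝ) < 1 / ((n : ℝ) + 1) := by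
    rw [Filter.eventually_all_finset]
    intro g _
    exact (hU.1 g).eventually (gt_mem_nhds hε)
  obtain ⟨N, hN1, hN2, hN3, hN4⟩ := (hev.and (hF.and (hU.2.and hΨ.2))).exists
  have c1 : (0:ℝ) < (uni k (Ψ N)).card := by exact_mod_cast hN3.card_pos
  have c2 : (0:ℝ) < (Ψ N).card := by exact_mod_cast hN4.card_pos
  refine ⟨uni k (Ψ N), hN3, ?_, fun g hg => ?_⟩
  · refine hN1.le.trans ?_
    have h1 : (half (uni k (Ψ N)) ∩ uni k (Ψ N)).card + (half (uni k (Ψ N)) \ uni k (Ψ N)).card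
        = (half (uni k (Ψ N))).card := Finset.card_inter_add_card_sdiff _ _
    have h2 := Finset.card_le_card (half_uni hk k (Ψ N))
    have h3 : ((half (uni k (Ψ N))).card : ℝ) ≤ (half (uni k (Ψ N)) ∩ uni k (Ψ N)).card
        + (half^[k + 1] (Ψ N)).card := by
      exact_mod_cast (by omega)
    have h4 : ((Ψ N).card : ℝ) ≤ (uni k (Ψ N)).card := by
      exact_mod_cast Finset.card_le_card (subset_uni k (Ψ N))
    have h5 : ((half^[k + 1] (Ψ N)).card : ℝ) / ((uni k (Ψ N)).card : ℝ) ≤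
        ((half^[k + 1] (Ψ N)).card : ℝ) / ((Ψ N).card : ℝ) := by gcongr
    have h6 : ((half (uni k (Ψ N))).card : ℝ) / ((uni k (Ψ N)).card : ℝ) ≤
        ((half (uni k (Ψ N)) ∩ uni k (Ψ N)).card : ℝ) / ((uni k (Ψ N)).card : ℝ)
        + ((half^[k + 1] (Ψ N)).card : ℝ) / ((uni k (Ψ N)).card : ℝ) := by
      rw [← add_div]
      gcongr
    linarith
  · exact ((div_lt_iff₀ c1).1 (hN2 g hg)).le

theorem ratio_le (A : Finset G) :
    ((half A ∩ A).card : ℝ) / (A.card : ℝ) ≤ ((half A).card : ℝ) / (A.card : ℝ) := by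
  have h : ((half A ∩ A).card : ℝ) ≤ (half A).card := by
    exact_mod_cast Finset.card_le_card Finset.inter_subset_left
  gcongr

theorem dratio_le (hk : Finite (doubleHom G).ker) (hH : (twoG G).index ≠ 0)
    (Φ : ℕ → Finset G) (hΦ : Fol Φ) :
    dratio Φ ≤ (Nat.card (doubleHom G).ker : ℝ) / ((twoG G).index : ℝ) := by
  have hT := half_density hk hH Φ hΦ
  unfold dratio
  simp only [ratio_eq hk]
  rw [← hT.liminf_eq]
  refine liminf_le_liminf (Eventually.of_forall fun N => ratio_le (Φ N)) ?_ ?_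
  · exact isBoundedUnder_of ⟨0, fun N => by positivity⟩
  · exact hT.isBoundedUnder_le.isCoboundedUnder_ge

end Aux

theorem stmt13 (G : Type*) [AddCommGroup G] [Countable G] (ℓ r : ℕ)
    (hr : 0 < r) (hrl : r < ℓ)
    (hindex : (twoG G).index = ℓ) (hker : Nat.card (doubleHom G).ker = r) :
    sSup {α : ℝ | ∃ Φ : ℕ → Finset G, IsFolner Φ ∧ α = dratio Φ} = (r : ℝ) / (ℓ : ℝ) ∧
    ∃ Φ : ℕ → Finset G, IsFolner Φ ∧ dratio Φ = (r : ℝ) / (ℓ : ℝ) := by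
  have hk : Finite (doubleHom G).ker := Nat.finite_of_card_ne_zero (by omega)
  have hH : (twoG G).index ≠ 0 := by omega
  subst hindex
  subst hker
  obtain ⟨Φ, hΦ, hlow⟩ := exists_good hk hH hrl
  have hval : dratio Φ = (Nat.card (doubleHom G).ker : ℝ) / ((twoG G).index : ℝ) := by
    unfold dratio
    simp only [ratio_eq hk]
    refine Tendsto.liminf_eq ?_
    have h1 := (tendsto_one_div_add_atTop_nhds_zero_nat (𝕜 := ℝ)).const_sub
      ((Nat.card (doubleHom G).ker : ℝ) / ((twoG G).index : ℝ))
    rw [sub_zero] at h1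
    exact tendsto_of_tendsto_of_tendsto_of_le_of_le h1 (half_density hk hH Φ hΦ) hlow
      (fun N => ratio_le (Φ N))
  refine ⟨IsGreatest.csSup_eq ⟨⟨Φ, (fol_iff Φ).2 hΦ, hval.symm⟩, ?_⟩, Φ, (fol_iff Φ).2 hΦ, hval⟩
  rintro _ ⟨Ψ, hΨ, rfl⟩
  exact dratio_le hk hH Ψ ((fol_iff Ψ).1 hΨ)
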